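/- arXiv:math/0509538 — 2 statements merged into one kernel-verified Lean document; each statement's English description precedes it below -/
import Mathlib

section
/- Let σ : T^n × (R^n \ {0}) → M_d(C) be a symbol such that |∂_x^α σ(x,ξ)| ≤ A for all |α| ≤ n+1 and |ξ| ≥ 1. Then the operator Op[σ] f(x) = Σ_{k ∈ Z^n, k ≠ 0} e^{i k·x} σ(x,k) f̂(k) is bounded on L^2(T^n; C^d) with operator norm at most c·A, where c depends only on n and d. -/
open MeasureTheory Real

noncomputable section

/-- Iterated partial derivative along a list of coordinate directions. -/
def pderivs {n : ℕ} {E : Type*} [NormedAddCommGroup E] [NormedSpace ℝ E] :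
    List (Fin n) → ((Fin n → ℝ) → E) → ((Fin n → ℝ) → E)
  | [], f => f
  | i :: L, f => fun x => fderiv ℝ (pderivs L f) x (Pi.single i 1)

/-- The `p`-th Fourier coefficient (in the periodic variable `x ∈ 𝕋ⁿ`, identified with the
fundamental domain `[0,1]ⁿ`) of a matrix-valued symbol `σ(x,ξ)`, at frequency `ξ`. -/
def symbolCoeff {n d : ℕ}
    (σ : (Fin n → ℝ) → (Fin n → ℝ) → ((Fin d → ℂ) →L[ℂ] (Fin d → ℂ)))
    (p : Fin n → ℤ) (ξ : Fin n → ℝ) : (Fin d → ℂ) →L[ℂ] (Fin d → ℂ) :=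
  ∫ x in Set.Icc (0 : Fin n → ℝ) 1,
    Complex.exp (-(2 * π * Complex.I) * (∑ i, (p i : ℝ) * x i)) • σ x ξ

/-- The `q`-th Fourier coefficient of `Op[σ] f`, where `f` is given by its Fourier
coefficients `f : ℤⁿ → ℂᵈ`:  `(Op[σ] f)^(q) = ∑_{k ≠ 0} σ̂(q − k, k) f̂(k)`. -/
def opCoeff {n d : ℕ}
    (σ : (Fin n → ℝ) → (Fin n → ℝ) → ((Fin d → ℂ) →L[ℂ] (Fin d → ℂ)))
    (f : (Fin n → ℤ) → (Fin d → ℂ)) (q : Fin n → ℤ) : Fin d → ℂ :=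
  ∑' k : Fin n → ℤ, if k = 0 then 0 else
    (symbolCoeff σ (q - k) (fun i => (k i : ℝ))) (f k)

theorem aux_summable_kernel (n : ℕ) :
    Summable (fun p : Fin n → ℤ => ‖p‖⁻¹ ^ (n + 1)) := by
  let b := Pi.basisFun ℝ (Fin n)
  let L : Submodule ℤ (Fin n → ℝ) := Submodule.span ℤ (Set.range b)
  have hr : Module.finrank ℤ L < n + 1 := by
    have : Module.finrank ℤ L = Module.finrank ℝ (Fin n → ℝ) := ZLattice.rank ℝ L
    rw [this]; simp
  have h := ZLattice.summable_norm_pow_inv L (n + 1) hr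
  have hm : ∀ p : Fin n → ℤ, (fun i => (p i : ℝ)) ∈ L := by
    intro p
    rw [b.mem_span_iff_repr_mem ℤ]
    intro i
    exact ⟨p i, by simp [b]⟩
  let φ : (Fin n → ℤ) → L := fun p => ⟨fun i => (p i : ℝ), hm p⟩
  have hφ : Function.Injective φ := by
    intro p q hpq
    have h1 := congrArg Subtype.val hpq
    funext i
    have h2 := congrFun h1 i
    exact Int.cast_injective (α := ℝ) h2
  refine (h.comp_injective hφ).congr fun p => ?_
  have : ‖φ p‖ = ‖p‖ := by
    change ‖(fun i => (p i : ℝ))‖ = ‖p‖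
    simp only [Pi.norm_def]
    congr 2
  rw [Function.comp_apply, this]

/-- Convolution kernel. -/
def auxK (n : ℕ) (p : Fin n → ℤ) : ℝ := if p = 0 then 1 else ‖p‖⁻¹ ^ (n + 1)

theorem auxK_nonneg (n : ℕ) (p : Fin n → ℤ) : 0 ≤ auxK n p := by
  unfold auxK; split_ifs <;> positivity

theorem auxK_summable (n : ℕ) : Summable (auxK n) := by
  refine (aux_summable_kernel n).congr_cofinite ?_
  rw [Filter.EventuallyEq, Filter.eventually_cofinite]
  refine (Set.finite_singleton (0 : Fin n → ℤ)).subset ?_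
  intro p hp
  by_contra h
  apply hp
  have : p ≠ 0 := h
  simp [auxK, this]

theorem auxK_tsum_pos (n : ℕ) : 0 < ∑' p, auxK n p :=
  (auxK_summable n).tsum_pos (auxK_nonneg n) 0 (by simp [auxK])

/-- Young / Schur inequality. -/
theorem aux_schur {G : Type*} [AddCommGroup G] (K F : G → ℝ) (hK : ∀ p, 0 ≤ K p)
    (hKs : Summable K) (hF : ∀ k, 0 ≤ F k) (hFs : Summable fun k => F k ^ 2) :
    (∀ q, Summable fun k => K (q - k) * F k) ∧
    (Summable fun q => (∑' k, K (q - k) * F k) ^ 2) ∧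
    ∑' q, (∑' k, K (q - k) * F k) ^ 2 ≤ (∑' p, K p) ^ 2 * ∑' k, F k ^ 2 := by
  let e : G × G ≃ G × G :=
    { toFun := fun x => (x.1 - x.2, x.2)
      invFun := fun x => (x.1 + x.2, x.2)
      left_inv := fun x => by simp
      right_inv := fun x => by simp }
  have hprod : Summable (fun x : G × G => K x.1 * F x.2 ^ 2) :=
    hKs.mul_of_nonneg hFs hK (fun k => sq_nonneg _)
  have hprod2 : Summable (fun x : G × G => K (x.1 - x.2) * F x.2 ^ 2) :=
    (e.summable_iff (f := fun x : G × G => K x.1 * F x.2 ^ 2)).2 hprod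
  have hKq : ∀ q, HasSum (fun k => K (q - k)) (∑' p, K p) := fun q =>
    ((Equiv.subLeft q).hasSum_iff (f := K)).2 hKs.hasSum
  have hin : ∀ q, Summable fun k => K (q - k) * F k ^ 2 := fun q =>
    hprod2.prod_factor q
  have hout : Summable fun q => ∑' k, K (q - k) * F k ^ 2 := hprod2.prod
  have htot : ∑' q, ∑' k, K (q - k) * F k ^ 2 = (∑' p, K p) * ∑' k, F k ^ 2 := by
    rw [← hprod2.tsum_prod, hKs.tsum_mul_tsum hFs hprod]
    exact e.tsum_eq (fun x : G × G => K x.1 * F x.2 ^ 2)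
  have hCS : ∀ q, (Summable fun k => K (q - k) * F k) ∧
      (∑' k, K (q - k) * F k) ^ 2 ≤ (∑' p, K p) * ∑' k, K (q - k) * F k ^ 2 := by
    intro q
    have e1 : ∀ k, √(K (q - k)) ^ (2 : ℝ) = K (q - k) := fun k => by
      rw [Real.rpow_two, Real.sq_sqrt (hK _)]
    have e2 : ∀ k, (√(K (q - k)) * F k) ^ (2 : ℝ) = K (q - k) * F k ^ 2 := fun k => by
      rw [Real.rpow_two, mul_pow, Real.sq_sqrt (hK _)]
    have e3 : ∀ k, √(K (q - k)) * (√(K (q - k)) * F k) = K (q - k) * F k := fun k => by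
      rw [← mul_assoc, Real.mul_self_sqrt (hK _)]
    have h := Real.summable_and_inner_le_Lp_mul_Lq_tsum_of_nonneg
      (f := fun k => √(K (q - k))) (g := fun k => √(K (q - k)) * F k)
      Real.HolderConjugate.two_two (fun k => Real.sqrt_nonneg _)
      (fun k => mul_nonneg (Real.sqrt_nonneg _) (hF k))
      (by simpa only [e1] using (hKq q).summable) (by simpa only [e2] using hin q)
    simp only [e1, e2, e3, (hKq q).tsum_eq] at h
    refine ⟨h.1, ?_⟩
    have h0 : 0 ≤ ∑' k, K (q - k) * F k := tsum_nonneg fun k => mul_nonneg (hK _) (hF _)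
    have hA : 0 ≤ ∑' p, K p := tsum_nonneg hK
    have hB : 0 ≤ ∑' k, K (q - k) * F k ^ 2 :=
      tsum_nonneg fun k => mul_nonneg (hK _) (sq_nonneg _)
    calc _ ≤ _ := pow_le_pow_left₀ h0 h.2 2
      _ = _ := by
        rw [← Real.sqrt_eq_rpow, ← Real.sqrt_eq_rpow, mul_pow, Real.sq_sqrt hA, Real.sq_sqrt hB]
  have hS : Summable fun q => (∑' k, K (q - k) * F k) ^ 2 :=
    Summable.of_nonneg_of_le (fun q => sq_nonneg _) (fun q => (hCS q).2) (hout.mul_left _)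
  refine ⟨fun q => (hCS q).1, hS, ?_⟩
  calc _ ≤ ∑' q, (∑' p, K p) * ∑' k, K (q - k) * F k ^ 2 :=
        hS.tsum_le_tsum (fun q => (hCS q).2) (hout.mul_left _)
    _ = _ := by rw [tsum_mul_left, htot]; ring

section
variable {E : Type*} [NormedAddCommGroup E] [NormedSpace ℝ E]

theorem aux_integral_deriv_zero {n : ℕ} (h : (Fin n → ℝ) → E) (hh : ContDiff ℝ 1 h)
    (hper : ∀ (x : Fin n → ℝ) (m : Fin n → ℤ), h (x + fun i => (m i : ℝ)) = h x) (i : Fin n) :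
    ∫ x in Set.Icc (0 : Fin n → ℝ) 1, fderiv ℝ h x (Pi.single i 1) = 0 := by
  cases n with
  | zero => exact i.elim0
  | succ n =>
  have hc : Continuous fun x => fderiv ℝ h x (Pi.single i 1) :=
    (hh.continuous_fderiv (by simp)).clm_apply continuous_const
  have hsum : ∀ x, ∑ j, (if j = i then fderiv ℝ h x else 0) (Pi.single j 1)
      = fderiv ℝ h x (Pi.single i 1) := by
    intro x
    rw [Finset.sum_eq_single i] <;> simp +contextual
  have key := integral_divergence_of_hasFDerivAt_off_countable' (E := E)
    (0 : Fin (n + 1) → ℝ) 1 zero_le_one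
    (fun j => if j = i then h else 0) (fun j x => if j = i then fderiv ℝ h x else 0) ∅
    Set.countable_empty
    (fun j => by
      split_ifs
      · exact hh.continuous.continuousOn
      · exact continuousOn_const)
    (fun x _ j => by
      split_ifs
      · exact (hh.differentiable (by simp) x).hasFDerivAt
      · exact hasFDerivAt_const _ _)
    (by
      simp only [hsum]
      exact hc.continuousOn.integrableOn_compact isCompact_Icc)
  simp only [hsum] at key
  rw [key]
  refine Finset.sum_eq_zero fun j _ => ?_
  split_ifs with hj
  · rw [sub_eq_zero]
    congr 1
    funext x
    subst hj
    rw [← hper (j.insertNth ((0 : Fin (n + 1) → ℝ) j) x) (Pi.single j 1)]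
    congr 1
    funext k
    refine Fin.succAboveCases j ?_ (fun l => ?_) k
    · simp
    · simp [Pi.single_apply, Fin.succAbove_ne]
  · simp

theorem aux_pderivs_contDiff {n : ℕ} (g : (Fin n → ℝ) → E) (hg : ContDiff ℝ (⊤ : ℕ∞) g)
    (L : List (Fin n)) : ContDiff ℝ (⊤ : ℕ∞) (pderivs L g) := by
  induction L with
  | nil => exact hg
  | cons i L ih =>
    exact (ih.fderiv_right (m := (⊤ : ℕ∞)) (by simp)).clm_apply contDiff_const

theorem aux_pderivs_periodic {n : ℕ} (g : (Fin n → ℝ) → E)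
    (hper : ∀ (x : Fin n → ℝ) (m : Fin n → ℤ), g (x + fun i => (m i : ℝ)) = g x)
    (L : List (Fin n)) (x : Fin n → ℝ) (m : Fin n → ℤ) :
    pderivs L g (x + fun i => (m i : ℝ)) = pderivs L g x := by
  induction L generalizing x with
  | nil => exact hper x m
  | cons i L ih =>
    change fderiv ℝ (pderivs L g) _ _ = fderiv ℝ (pderivs L g) _ _
    rw [← fderiv_comp_add_right]
    simp only [ih]

variable [NormedSpace ℂ E] [IsScalarTower ℝ ℂ E]

/-- Fourier coefficient. -/
def auxC {n : ℕ} (g : (Fin n → ℝ) → E) (p : Fin n → ℤ) : E :=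
  ∫ x in Set.Icc (0 : Fin n → ℝ) 1,
    Complex.exp (-(2 * π * Complex.I) * (∑ i, (p i : ℝ) * x i : ℝ)) • g x

theorem aux_exp_contDiff {n : ℕ} (p : Fin n → ℤ) : ContDiff ℝ (⊤ : ℕ∞)
    (fun x : Fin n → ℝ =>
      Complex.exp (-(2 * π * Complex.I) * (∑ i, (p i : ℝ) * x i : ℝ))) := by
  have h1 : ContDiff ℝ (⊤ : ℕ∞) (fun x : Fin n → ℝ => ∑ i, (p i : ℝ) * x i) := by fun_prop
  exact (contDiff_const.mul (Complex.ofRealCLM.contDiff.comp h1)).cexp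

theorem aux_exp_norm {n : ℕ} (p : Fin n → ℤ) (x : Fin n → ℝ) :
    ‖Complex.exp (-(2 * π * Complex.I) * (∑ i, (p i : ℝ) * x i : ℝ))‖ = 1 := by
  rw [show (-(2 * π * Complex.I) * ((∑ i, (p i : ℝ) * x i : ℝ) : ℂ))
    = ((-(2 * π) * ∑ i, (p i : ℝ) * x i : ℝ) : ℂ) * Complex.I by push_cast; ring]
  exact Complex.norm_exp_ofReal_mul_I _

theorem aux_exp_periodic {n : ℕ} (p : Fin n → ℤ) (x : Fin n → ℝ) (m : Fin n → ℤ) :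
    Complex.exp (-(2 * π * Complex.I) *
      (∑ i, (p i : ℝ) * (x + fun i => (m i : ℝ)) i : ℝ)) =
    Complex.exp (-(2 * π * Complex.I) * (∑ i, (p i : ℝ) * x i : ℝ)) := by
  rw [Complex.exp_eq_exp_iff_exists_int]
  refine ⟨-∑ i, p i * m i, ?_⟩
  simp only [Pi.add_apply, mul_add, Finset.sum_add_distrib]
  push_cast
  ring

theorem aux_exp_fderiv {n : ℕ} (p : Fin n → ℤ) (x : Fin n → ℝ) (i : Fin n) :
    fderiv ℝ (fun x : Fin n → ℝ =>
      Complex.exp (-(2 * π * Complex.I) * (∑ i, (p i : ℝ) * x i : ℝ))) x (Pi.single i 1) =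
    -(2 * π * Complex.I * p i) *
      Complex.exp (-(2 * π * Complex.I) * (∑ i, (p i : ℝ) * x i : ℝ)) := by
  let ℓ : (Fin n → ℝ) →L[ℝ] ℝ := ∑ i, (p i : ℝ) • ContinuousLinearMap.proj i
  have hℓ : ∀ x, ℓ x = ∑ i, (p i : ℝ) * x i := fun x => by simp [ℓ]
  simp only [← hℓ]
  have h1 : HasFDerivAt (fun x : Fin n → ℝ => (ℓ x : ℂ)) (Complex.ofRealCLM.comp ℓ) x :=
    (Complex.ofRealCLM.comp ℓ).hasFDerivAt
  have h2 := (h1.const_mul (-(2 * π * Complex.I))).cexp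
  rw [h2.fderiv]
  simp [hℓ, Pi.single_apply]
  ring

theorem aux_C_deriv {n : ℕ} (g : (Fin n → ℝ) → E) (hg : ContDiff ℝ (⊤ : ℕ∞) g)
    (hper : ∀ (x : Fin n → ℝ) (m : Fin n → ℤ), g (x + fun i => (m i : ℝ)) = g x)
    (p : Fin n → ℤ) (i : Fin n) :
    auxC (fun x => fderiv ℝ g x (Pi.single i 1)) p = (2 * π * Complex.I * p i) • auxC g p := by
  have he := aux_exp_contDiff p
  have h0 := aux_integral_deriv_zero
    (fun x => Complex.exp (-(2 * π * Complex.I) * (∑ i, (p i : ℝ) * x i : ℝ)) • g x)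
    ((he.smul hg).of_le (by simp)) (fun x m => by rw [aux_exp_periodic, hper]) i
  have hd : ∀ x, fderiv ℝ
      (fun x => Complex.exp (-(2 * π * Complex.I) * (∑ i, (p i : ℝ) * x i : ℝ)) • g x) x
        (Pi.single i 1) =
      Complex.exp (-(2 * π * Complex.I) * (∑ i, (p i : ℝ) * x i : ℝ)) •
        fderiv ℝ g x (Pi.single i 1) -
      (2 * π * Complex.I * p i) •
        (Complex.exp (-(2 * π * Complex.I) * (∑ i, (p i : ℝ) * x i : ℝ)) • g x) := by
    intro x
    have := fderiv_fun_smul (he.differentiable (by simp) x) (hg.differentiable (by simp) x)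
    rw [this]
    simp only [add_apply, smul_apply,
      ContinuousLinearMap.smulRight_apply]
    rw [aux_exp_fderiv, mul_smul, neg_smul, ← sub_eq_add_neg]
  simp only [hd] at h0
  have hc : Continuous fun x => fderiv ℝ g x (Pi.single i 1) :=
    (hg.continuous_fderiv (by simp)).clm_apply continuous_const
  rw [integral_sub, integral_smul, sub_eq_zero] at h0
  · exact h0
  · exact (he.continuous.smul hc).continuousOn.integrableOn_compact isCompact_Icc
  · exact ((he.continuous.smul hg.continuous).const_smul _).continuousOn.integrableOn_compact
      isCompact_Icc

theorem aux_C_pderivs {n : ℕ} (g : (Fin n → ℝ) → E) (hg : ContDiff ℝ (⊤ : ℕ∞) g)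
    (hper : ∀ (x : Fin n → ℝ) (m : Fin n → ℤ), g (x + fun i => (m i : ℝ)) = g x)
    (p : Fin n → ℤ) (i : Fin n) (N : ℕ) :
    auxC (pderivs (List.replicate N i) g) p = (2 * π * Complex.I * p i) ^ N • auxC g p := by
  induction N with
  | zero => simp [pderivs]
  | succ N ih =>
    have := aux_C_deriv _ (aux_pderivs_contDiff g hg (List.replicate N i))
      (aux_pderivs_periodic g hper _) p i
    rw [ih, smul_smul, ← pow_succ'] at this
    exact this

theorem aux_C_norm {n : ℕ} (g : (Fin n → ℝ) → E) (p : Fin n → ℤ) (A : ℝ)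
    (hA : ∀ x, ‖g x‖ ≤ A) : ‖auxC g p‖ ≤ A := by
  have hv : volume (Set.Icc (0 : Fin n → ℝ) 1) = 1 := by simp [Real.volume_Icc_pi]
  have := norm_setIntegral_le_of_norm_le_const (μ := volume) (C := A)
    (s := Set.Icc (0 : Fin n → ℝ) 1)
    (f := fun x => Complex.exp (-(2 * π * Complex.I) * (∑ i, (p i : ℝ) * x i : ℝ)) • g x)
    (by rw [hv]; simp) (fun x _ => by rw [norm_smul, aux_exp_norm, one_mul]; exact hA x)
  rwa [Measure.real, hv, ENNReal.toReal_one, mul_one] at this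

theorem aux_C_bound {n : ℕ} (g : (Fin n → ℝ) → E) (hg : ContDiff ℝ (⊤ : ℕ∞) g)
    (hper : ∀ (x : Fin n → ℝ) (m : Fin n → ℤ), g (x + fun i => (m i : ℝ)) = g x) (A : ℝ)
    (hA : ∀ L : List (Fin n), L.length ≤ n + 1 → ∀ x, ‖pderivs L g x‖ ≤ A)
    (p : Fin n → ℤ) : ‖auxC g p‖ ≤ A * auxK n p := by
  unfold auxK
  split_ifs with hp
  · rw [mul_one]
    exact aux_C_norm g p A (hA [] (by simp))
  · have hne : Nonempty (Fin n) := by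
      obtain ⟨i, -⟩ := Function.ne_iff.1 hp
      exact ⟨i⟩
    obtain ⟨i, hi⟩ : ∃ i, ‖p i‖ = ‖p‖ := by
      obtain ⟨i, hi⟩ := Finite.exists_max fun j => ‖p j‖
      exact ⟨i, le_antisymm (norm_le_pi_norm p i) ((pi_norm_le_iff_of_nonneg (norm_nonneg _)).2 hi)⟩
    have hpos : 0 < ‖p‖ := norm_pos_iff.2 hp
    have h1 := aux_C_norm _ p A (hA (List.replicate (n + 1) i) (by simp))
    rw [aux_C_pderivs g hg hper, norm_smul, norm_pow] at h1
    have h2 : ‖p‖ ≤ ‖(2 * π * Complex.I * p i : ℂ)‖ := by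
      have : ‖(2 * π * Complex.I * p i : ℂ)‖ = 2 * π * ‖p‖ := by
        rw [← hi]
        simp [abs_of_pos Real.pi_pos, Int.norm_eq_abs]
      rw [this]
      nlinarith [Real.pi_gt_three]
    have h3 : ‖p‖ ^ (n + 1) * ‖auxC g p‖ ≤ A := le_trans (by gcongr) h1
    rw [inv_pow, ← div_eq_mul_inv, le_div_iff₀ (by positivity)]
    linarith
end

/-- If the symbol `σ : 𝕋ⁿ × (ℝⁿ∖{0}) → M_d(ℂ)` satisfies
`|∂_x^α σ(x,ξ)| ≤ A` for all `|α| ≤ n+1` and `|ξ| ≥ 1`, then the operator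
`Op[σ] f(x) = ∑_{k ≠ 0} e^{ik·x} σ(x,k) f̂(k)` is bounded on `L²(𝕋ⁿ; ℂᵈ)` with
operator norm at most `c·A`, where `c` depends only on `n` and `d`. -/
theorem op_l2_bounded (n d : ℕ) :
    ∃ c : ℝ, 0 < c ∧
      ∀ (σ : (Fin n → ℝ) → (Fin n → ℝ) → ((Fin d → ℂ) →L[ℂ] (Fin d → ℂ))) (A : ℝ),
        (∀ (x : Fin n → ℝ) (m : Fin n → ℤ) ξ, σ (x + fun i => (m i : ℝ)) ξ = σ x ξ) →
        (∀ ξ : Fin n → ℝ, ξ ≠ 0 → ContDiff ℝ (⊤ : ℕ∞) (fun x => σ x ξ)) →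
        (∀ L : List (Fin n), L.length ≤ n + 1 →
          ∀ (x ξ : Fin n → ℝ), 1 ≤ ‖ξ‖ → ‖pderivs L (fun y => σ y ξ) x‖ ≤ A) →
        ∀ f : (Fin n → ℤ) → (Fin d → ℂ), Summable (fun k => ‖f k‖ ^ 2) →
          Summable (fun q => ‖opCoeff σ f q‖ ^ 2) ∧
          (∑' q, ‖opCoeff σ f q‖ ^ 2) ≤ (c * A) ^ 2 * ∑' k, ‖f k‖ ^ 2 := by
  refine ⟨∑' p, auxK n p, auxK_tsum_pos n, ?_⟩
  intro σ A hper hsm hbd f hf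
  obtain ⟨hS1, hS2, hS3⟩ := aux_schur (auxK n) (fun k => ‖f k‖) (auxK_nonneg n)
    (auxK_summable n) (fun k => norm_nonneg _) hf
  have hterm : ∀ q k : Fin n → ℤ, ‖(if k = 0 then 0 else
      (symbolCoeff σ (q - k) (fun i => (k i : ℝ))) (f k))‖ ≤ |A| * (auxK n (q - k) * ‖f k‖) := by
    intro q k
    have hnn : 0 ≤ auxK n (q - k) * ‖f k‖ := mul_nonneg (auxK_nonneg n _) (norm_nonneg _)
    split_ifs with hk
    · rw [norm_zero]
      exact mul_nonneg (abs_nonneg _) hnn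
    · have hk1 : 1 ≤ ‖(fun i => (k i : ℝ))‖ := by
        obtain ⟨i, hi⟩ := Function.ne_iff.1 hk
        refine le_trans ?_ (norm_le_pi_norm _ i)
        rw [Real.norm_eq_abs]
        exact_mod_cast Int.one_le_abs hi
      have hk0 : (fun i => (k i : ℝ)) ≠ 0 := by
        intro h
        rw [h, norm_zero] at hk1
        linarith
      have h1 : ‖symbolCoeff σ (q - k) (fun i => (k i : ℝ))‖ ≤ A * auxK n (q - k) :=
        aux_C_bound (fun x => σ x (fun i => (k i : ℝ))) (hsm _ hk0) (fun x m => hper x m _) A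
          (fun L hL x => hbd L hL x _ hk1) (q - k)
      calc _ ≤ _ := ContinuousLinearMap.le_opNorm _ _
        _ ≤ (A * auxK n (q - k)) * ‖f k‖ := by gcongr
        _ = A * (auxK n (q - k) * ‖f k‖) := by ring
        _ ≤ _ := by gcongr; exact le_abs_self A
  have hq : ∀ q, ‖opCoeff σ f q‖ ≤ |A| * ∑' k, auxK n (q - k) * ‖f k‖ := by
    intro q
    rw [← tsum_mul_left]
    exact tsum_of_norm_bounded ((hS1 q).mul_left _).hasSum (hterm q)
  have hq2 : ∀ q, ‖opCoeff σ f q‖ ^ 2 ≤ A ^ 2 * (∑' k, auxK n (q - k) * ‖f k‖) ^ 2 := by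
    intro q
    rw [← sq_abs A, ← mul_pow]
    exact pow_le_pow_left₀ (norm_nonneg _) (hq q) 2
  have hsum : Summable (fun q => ‖opCoeff σ f q‖ ^ 2) :=
    Summable.of_nonneg_of_le (fun q => sq_nonneg _) hq2 (hS2.mul_left _)
  refine ⟨hsum, ?_⟩
  calc _ ≤ ∑' q, A ^ 2 * (∑' k, auxK n (q - k) * ‖f k‖) ^ 2 :=
        hsum.tsum_le_tsum hq2 (hS2.mul_left _)
    _ = A ^ 2 * ∑' q, (∑' k, auxK n (q - k) * ‖f k‖) ^ 2 := tsum_mul_left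
    _ ≤ A ^ 2 * ((∑' p, auxK n p) ^ 2 * ∑' k, ‖f k‖ ^ 2) := by gcongr
    _ = _ := by ring

end
end

section
/- Let {σ_ι}_{ι ∈ I} be a family of symbols on T^n × (R^n \ {0}) such that there is A > 0 with |∂_x^α σ_ι(x,ξ)| ≤ A |ξ|^{-1} for all |ξ| ≥ 1, all |α| ≤ n+1, and all ι. Then the family of operators U_ι = Op[σ_ι] is uniformly compact: with P_N the Fourier projection onto frequencies |k| < N, one has sup_ι ‖U_ι − U_ι P_N‖ → 0 as N → ∞. Quantitatively, ‖U_ι(I − P_N)‖ ≤ C A / N with C depending only on n. -/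
open MeasureTheory Real

noncomputable section

/-- The weight `w(p)` bounding the Fourier coefficients of a symbol. -/
def wt {n : ℕ} (p : Fin n → ℤ) : ℝ :=
  ‖(fun i => (p i : ℝ))‖⁻¹ ^ (n + 1) + if p = 0 then 1 else 0

lemma wt_nonneg {n : ℕ} (p : Fin n → ℤ) : 0 ≤ wt p := by
  unfold wt; split_ifs <;> positivity

lemma summable_wt (n : ℕ) : Summable (wt (n := n)) := by
  unfold wt
  refine Summable.add ?_ (summable_of_hasFiniteSupport ?_)
  · let L := Submodule.span ℤ (Set.range (Pi.basisFun ℝ (Fin n)))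
    have h := ZLattice.summable_norm_pow_inv L (n + 1) (by
      rw [ZLattice.rank ℝ L]; simp)
    have hm : ∀ p : Fin n → ℤ, (fun i => (p i : ℝ)) ∈ L := by
      intro p
      refine ((Pi.basisFun ℝ (Fin n)).mem_span_iff_repr_mem ℤ _).2 fun i => ⟨p i, by simp⟩
    have hinj : Function.Injective (fun p : Fin n → ℤ => (⟨fun i => (p i : ℝ), hm p⟩ : L)) := by
      intro p q hpq
      have := congrArg Subtype.val hpq
      funext i
      have h2 : (p i : ℝ) = q i := congrFun this i
      exact_mod_cast h2
    have h3 := h.comp_injective hinj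
    refine h3.congr fun p => ?_
    simp only [Function.comp_apply, Submodule.coe_norm]
  · refine (Set.finite_singleton (0 : Fin n → ℤ)).subset ?_
    intro p hp
    by_contra h
    simp at h
    simp [h] at hp

set_option maxHeartbeats 1600000 in
lemma young {G : Type*} [AddCommGroup G] (w F : G → ℝ) (hw : ∀ p, 0 ≤ w p) (hws : Summable w)
    (hF : ∀ k, 0 ≤ F k) (hFs : Summable fun k => F k ^ 2) :
    (∀ q, Summable fun k => w (q - k) * F k) ∧
    (Summable fun q => (∑' k, w (q - k) * F k) ^ 2) ∧
    (∑' q, (∑' k, w (q - k) * F k) ^ 2) ≤ (∑' p, w p) ^ 2 * ∑' k, F k ^ 2 := by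
  have hF2 : ∀ k, 0 ≤ F k ^ 2 := fun k => sq_nonneg _
  have hprod : Summable fun x : G × G => w x.1 * F x.2 ^ 2 :=
    hws.mul_of_nonneg hFs hw hF2
  let e : G × G ≃ G × G :=
    { toFun := fun x => (x.1 - x.2, x.2)
      invFun := fun x => (x.1 + x.2, x.2)
      left_inv := fun x => by simp
      right_inv := fun x => by simp }
  have hprod' : Summable fun x : G × G => w (x.1 - x.2) * F x.2 ^ 2 := by
    have h := hprod.comp_injective e.injective
    exact h
  have hG : ∀ q, Summable fun k => w (q - k) * F k ^ 2 := fun q => hprod'.prod_factor q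
  have hGs : Summable fun q => ∑' k, w (q - k) * F k ^ 2 := hprod'.prod
  have hGt : (∑' q, ∑' k, w (q - k) * F k ^ 2) = (∑' p, w p) * ∑' k, F k ^ 2 := by
    rw [← hprod'.tsum_prod, hws.tsum_mul_tsum hFs hprod]
    have h := e.tsum_eq (fun x : G × G => w x.1 * F x.2 ^ 2)
    exact h
  have hW : 0 ≤ ∑' p, w p := tsum_nonneg hw
  have hws' : ∀ q, Summable fun k => w (q - k) := fun q =>
    (Equiv.subLeft q).summable_iff (f := w) |>.2 hws
  have hwt' : ∀ q, ∑' k, w (q - k) = ∑' p, w p := fun q => (Equiv.subLeft q).tsum_eq w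
  have hG0 : ∀ q, 0 ≤ ∑' k, w (q - k) * F k ^ 2 := fun q =>
    tsum_nonneg fun k => mul_nonneg (hw _) (hF2 _)
  have hr0 : ∀ q k, 0 ≤ w (q - k) * F k := fun q k => mul_nonneg (hw _) (hF _)
  have key : ∀ q (s : Finset G), ∑ k ∈ s, w (q - k) * F k ≤
      Real.sqrt ((∑' p, w p) * ∑' k, w (q - k) * F k ^ 2) := by
    intro q s
    apply Real.le_sqrt_of_sq_le
    refine (Finset.sum_sq_le_sum_mul_sum_of_sq_le_mul s (f := fun k => w (q - k))
      (g := fun k => w (q - k) * F k ^ 2) (fun k _ => hw _)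
      (fun k _ => mul_nonneg (hw _) (hF2 _)) (fun k _ => le_of_eq (by ring))).trans ?_
    refine mul_le_mul ?_ ((hG q).sum_le_tsum s fun k _ => mul_nonneg (hw _) (hF2 _))
      (Finset.sum_nonneg fun k _ => mul_nonneg (hw _) (hF2 _)) hW
    rw [← hwt' q]
    exact (hws' q).sum_le_tsum s fun k _ => hw _
  have hS : ∀ q, Summable fun k => w (q - k) * F k := fun q =>
    summable_of_sum_le (hr0 q) (key q)
  have hB : ∀ q, (∑' k, w (q - k) * F k) ^ 2 ≤ (∑' p, w p) * ∑' k, w (q - k) * F k ^ 2 := by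
    intro q
    have h1 : ∑' k, w (q - k) * F k ≤ Real.sqrt ((∑' p, w p) * ∑' k, w (q - k) * F k ^ 2) :=
      Real.tsum_le_of_sum_le (hr0 q) (key q)
    calc _ ≤ (Real.sqrt ((∑' p, w p) * ∑' k, w (q - k) * F k ^ 2)) ^ 2 :=
          pow_le_pow_left₀ (tsum_nonneg (hr0 q)) h1 2
      _ = _ := Real.sq_sqrt (mul_nonneg hW (hG0 q))
  have hsum : Summable fun q => (∑' k, w (q - k) * F k) ^ 2 :=
    Summable.of_nonneg_of_le (fun q => sq_nonneg _) hB (hGs.mul_left _)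
  refine ⟨hS, hsum, ?_⟩
  calc _ ≤ ∑' q, (∑' p, w p) * ∑' k, w (q - k) * F k ^ 2 :=
        hsum.tsum_le_tsum hB (hGs.mul_left _)
    _ = _ := by rw [tsum_mul_left, hGt]; ring

/-- The character `e^{-2πi p·x}`. -/
def chr {n : ℕ} (p : Fin n → ℤ) (x : Fin n → ℝ) : ℂ :=
  Complex.exp (-(2 * π * Complex.I) * (∑ i, (p i : ℝ) * x i : ℝ))

lemma norm_chr {n : ℕ} (p : Fin n → ℤ) (x : Fin n → ℝ) : ‖chr p x‖ = 1 := by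
  unfold chr
  rw [show -(2 * (π : ℂ) * Complex.I) * ((∑ i, (p i : ℝ) * x i : ℝ) : ℂ) =
    ((-(2 * π) * ∑ i, (p i : ℝ) * x i : ℝ) : ℂ) * Complex.I by push_cast; ring]
  exact Complex.norm_exp_ofReal_mul_I _

lemma chr_per {n : ℕ} (p : Fin n → ℤ) (x : Fin n → ℝ) (m : Fin n → ℤ) :
    chr p (x + fun i => (m i : ℝ)) = chr p x := by
  unfold chr
  rw [Complex.exp_eq_exp_iff_exists_int]
  refine ⟨-∑ i, p i * m i, ?_⟩
  simp only [Pi.add_apply, mul_add, Finset.sum_add_distrib]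
  push_cast
  ring

/-- The phase as a continuous linear map. -/
def phase {n : ℕ} (p : Fin n → ℤ) : (Fin n → ℝ) →L[ℝ] ℝ :=
  ∑ i, (p i : ℝ) • ContinuousLinearMap.proj (R := ℝ) (φ := fun _ : Fin n => ℝ) i

lemma phase_apply {n : ℕ} (p : Fin n → ℤ) (x : Fin n → ℝ) :
    phase p x = ∑ i, (p i : ℝ) * x i := by
  simp [phase]

lemma chr_eq {n : ℕ} (p : Fin n → ℤ) :
    chr p = fun x => Complex.exp (-(2 * π * Complex.I) * (phase p x : ℝ)) := by
  funext x; rw [phase_apply]; rfl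

lemma chr_hasFDerivAt {n : ℕ} (p : Fin n → ℤ) (x : Fin n → ℝ) :
    HasFDerivAt (chr p) (chr p x • ((-(2 * π * Complex.I)) •
      (Complex.ofRealCLM.comp (phase p)))) x := by
  have h : HasFDerivAt (fun x => -(2 * π * Complex.I) * (phase p x : ℝ))
      ((-(2 * π * Complex.I)) • (Complex.ofRealCLM.comp (phase p))) x :=
    ((Complex.ofRealCLM.comp (phase p)).hasFDerivAt).const_mul _
  rw [chr_eq]
  exact h.cexp

lemma chr_contDiff {n : ℕ} (p : Fin n → ℤ) : ContDiff ℝ (⊤ : ℕ∞) (chr p) := by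
  rw [chr_eq]
  exact (contDiff_const.mul (Complex.ofRealCLM.contDiff.comp (phase p).contDiff)).cexp

section ibp
variable {E : Type*} [NormedAddCommGroup E] [NormedSpace ℝ E]

lemma integral_deriv_periodic [CompleteSpace E] {n : ℕ} (h : (Fin n → ℝ) → E)
    (hper : ∀ x (m : Fin n → ℤ), h (x + fun i => (m i : ℝ)) = h x)
    (hc : ContDiff ℝ (⊤ : ℕ∞) h) (i : Fin n) :
    ∫ x in Set.Icc (0 : Fin n → ℝ) 1, fderiv ℝ h x (Pi.single i 1) = 0 := by
  obtain _ | n := n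
  · exact i.elim0
  have hd : Differentiable ℝ h := hc.differentiable (by simp)
  have hcd : Continuous fun x => fderiv ℝ h x (Pi.single i 1) :=
    (hc.continuous_fderiv (by simp)).clm_apply continuous_const
  have hs : ∀ x, (∑ j, (if j = i then fderiv ℝ h x else 0) (Pi.single j 1)) =
      fderiv ℝ h x (Pi.single i 1) := by
    intro x
    rw [Finset.sum_eq_single i]
    · simp
    · intro j _ hj; simp [hj]
    · simp
  have := integral_divergence_of_hasFDerivAt_off_countable' (0 : Fin (n + 1) → ℝ) 1
    zero_le_one (fun j x => if j = i then h x else 0)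
    (fun j x => if j = i then fderiv ℝ h x else 0) ∅ Set.countable_empty
    (by
      intro j
      by_cases hj : j = i
      · simpa [hj] using hc.continuous.continuousOn
      · simpa [hj] using continuousOn_const)
    (by
      intro x _ j
      by_cases hj : j = i
      · simpa [hj] using (hd x).hasFDerivAt
      · simpa [hj] using hasFDerivAt_const (0 : E) x)
    (by
      simp only [hs]
      exact hcd.continuousOn.integrableOn_compact isCompact_Icc)
  simp only [hs] at this
  rw [this]
  apply Finset.sum_eq_zero
  intro j _
  rw [sub_eq_zero]
  congr 1
  funext x
  by_cases hj : j = i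
  · subst hj
    simp only [if_true]
    rw [← hper (j.insertNth ((0 : Fin (n + 1) → ℝ) j) x) (Pi.single j 1)]
    congr 1
    funext k
    refine Fin.succAboveCases j ?_ (fun k => ?_) k <;> simp
  · simp [hj]

lemma pderivs_contDiff {n : ℕ} (g : (Fin n → ℝ) → E) (hc : ContDiff ℝ (⊤ : ℕ∞) g)
    (L : List (Fin n)) : ContDiff ℝ (⊤ : ℕ∞) (pderivs L g) := by
  induction L with
  | nil => exact hc
  | cons i L ih =>
    exact (ih.fderiv_right (m := (⊤ : ℕ∞)) (by simp)).clm_apply contDiff_const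

lemma pderivs_per {n : ℕ} (g : (Fin n → ℝ) → E)
    (hper : ∀ x (m : Fin n → ℤ), g (x + fun i => (m i : ℝ)) = g x)
    (L : List (Fin n)) (x : Fin n → ℝ) (m : Fin n → ℤ) :
    pderivs L g (x + fun i => (m i : ℝ)) = pderivs L g x := by
  induction L generalizing x with
  | nil => exact hper x m
  | cons i L ih =>
    change fderiv ℝ (pderivs L g) (x + fun i => (m i : ℝ)) _ = fderiv ℝ (pderivs L g) x _
    rw [← fderiv_comp_add_right]
    congr 2
    funext y
    exact ih y

variable [NormedSpace ℂ E] [IsScalarTower ℝ ℂ E] [CompleteSpace E]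

lemma ibp {n : ℕ} (g : (Fin n → ℝ) → E)
    (hper : ∀ x (m : Fin n → ℤ), g (x + fun i => (m i : ℝ)) = g x)
    (hc : ContDiff ℝ (⊤ : ℕ∞) g) (p : Fin n → ℤ) (i : Fin n) :
    ∫ x in Set.Icc (0 : Fin n → ℝ) 1, chr p x • fderiv ℝ g x (Pi.single i 1) =
      (2 * π * Complex.I * p i) • ∫ x in Set.Icc (0 : Fin n → ℝ) 1, chr p x • g x := by
  have hch := chr_contDiff p
  have h0 := integral_deriv_periodic (fun x => chr p x • g x)
    (fun x m => by simp only [chr_per, hper]) (hch.smul hc) i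
  have hf : ∀ x, fderiv ℝ (fun x => chr p x • g x) x (Pi.single i 1) =
      chr p x • fderiv ℝ g x (Pi.single i 1) - (2 * π * Complex.I * p i) • (chr p x • g x) := by
    intro x
    have := ((chr_hasFDerivAt p x).smul (hc.differentiable (by simp) x).hasFDerivAt).fderiv
    change fderiv ℝ (chr p • g) x (Pi.single i 1) = _
    rw [this]
    simp [phase_apply, Pi.single_apply, sub_eq_add_neg, ← neg_smul, smul_smul]
    congr 1
    ring
  simp only [hf] at h0
  rw [integral_sub, integral_smul, sub_eq_zero] at h0
  · exact h0
  · exact (hch.continuous.smul ((hc.continuous_fderiv (by simp)).clm_apply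
      continuous_const)).continuousOn.integrableOn_compact isCompact_Icc
  · exact ((hch.continuous.smul hc.continuous).const_smul _).continuousOn.integrableOn_compact
      isCompact_Icc

lemma ibp_iter {n : ℕ} (g : (Fin n → ℝ) → E)
    (hper : ∀ x (m : Fin n → ℤ), g (x + fun i => (m i : ℝ)) = g x)
    (hc : ContDiff ℝ (⊤ : ℕ∞) g) (p : Fin n → ℤ) (i : Fin n) (m : ℕ) :
    ∫ x in Set.Icc (0 : Fin n → ℝ) 1, chr p x • pderivs (List.replicate m i) g x =
      (2 * π * Complex.I * p i) ^ m • ∫ x in Set.Icc (0 : Fin n → ℝ) 1, chr p x • g x := by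
  induction m with
  | zero => simp [pderivs]
  | succ m ih =>
    rw [pow_succ', mul_smul, ← ih]
    exact ibp _ (pderivs_per g hper _) (pderivs_contDiff g hc _) p i

lemma norm_int_le {n : ℕ} (g : (Fin n → ℝ) → E) (p : Fin n → ℤ) (B : ℝ)
    (hB : ∀ x, ‖g x‖ ≤ B) :
    ‖∫ x in Set.Icc (0 : Fin n → ℝ) 1, chr p x • g x‖ ≤ B := by
  have := norm_setIntegral_le_of_norm_le_const (μ := volume) (s := Set.Icc (0 : Fin n → ℝ) 1)
    (f := fun x => chr p x • g x) (C := B) (isCompact_Icc.measure_lt_top)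
    (fun x _ => by rw [norm_smul, norm_chr, one_mul]; exact hB x)
  simpa [measureReal_def, Real.volume_Icc_pi] using this

lemma coeff_bound {n : ℕ} (g : (Fin n → ℝ) → E)
    (hper : ∀ x (m : Fin n → ℤ), g (x + fun i => (m i : ℝ)) = g x)
    (hc : ContDiff ℝ (⊤ : ℕ∞) g) (B : ℝ)
    (hB : ∀ L : List (Fin n), L.length ≤ n + 1 → ∀ x, ‖pderivs L g x‖ ≤ B) (p : Fin n → ℤ) :
    ‖∫ x in Set.Icc (0 : Fin n → ℝ) 1, chr p x • g x‖ ≤ B * wt p := by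
  have hB0 : 0 ≤ B := (norm_nonneg _).trans (hB [] (by simp) 0)
  by_cases hp : p = 0
  · refine (norm_int_le g p B (hB [] (by simp))).trans ?_
    have : 1 ≤ wt p := by simp [wt, hp]
    nlinarith
  have hn : Nonempty (Fin n) := by
    by_contra h
    rw [not_nonempty_iff] at h
    exact hp (Subsingleton.elim _ _)
  obtain ⟨i, hi⟩ : ∃ i, ‖(fun i => (p i : ℝ))‖ = ‖(p i : ℝ)‖ := by
    obtain ⟨i, -, hi⟩ := Finset.exists_max_image Finset.univ (fun i => ‖(p i : ℝ)‖)
      Finset.univ_nonempty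
    exact ⟨i, le_antisymm ((pi_norm_le_iff_of_nonneg (norm_nonneg _)).2
      fun j => hi j (Finset.mem_univ _)) (norm_le_pi_norm (fun i => (p i : ℝ)) i)⟩
  have hpos : 0 < ‖(fun i => (p i : ℝ))‖ := by
    rw [norm_pos_iff]
    intro h
    apply hp
    funext j
    have h2 : (p j : ℝ) = 0 := congrFun h j
    exact_mod_cast h2
  have h1 := ibp_iter g hper hc p i (n + 1)
  have h2 := norm_int_le (pderivs (List.replicate (n + 1) i) g) p B (hB _ (by simp))
  rw [h1, norm_smul, norm_pow] at h2
  have h3 : ‖(fun i => (p i : ℝ))‖ ≤ ‖2 * (π : ℂ) * Complex.I * p i‖ := by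
    have : ‖2 * (π : ℂ) * Complex.I * p i‖ = 2 * π * ‖(fun i => (p i : ℝ))‖ := by
      rw [hi]
      simp [abs_of_pos Real.pi_pos]
    rw [this]
    nlinarith [Real.pi_gt_three]
  have h4 := pow_le_pow_left₀ hpos.le h3 (n + 1)
  have h5 := (mul_le_mul_of_nonneg_right h4 (norm_nonneg _)).trans h2
  simp only [wt, hp, if_false, add_zero, inv_pow]
  rw [← div_eq_mul_inv, le_div_iff₀ (pow_pos hpos _), mul_comm]
  exact h5

end ibp

lemma op_bound {n d : ℕ}
    (σ : (Fin n → ℝ) → (Fin n → ℝ) → ((Fin d → ℂ) →L[ℂ] (Fin d → ℂ)))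
    (A : ℝ) (hA : 0 < A)
    (hper : ∀ (x : Fin n → ℝ) (m : Fin n → ℤ) ξ, σ (x + fun i => (m i : ℝ)) ξ = σ x ξ)
    (hc : ∀ ξ : Fin n → ℝ, ξ ≠ 0 → ContDiff ℝ (⊤ : ℕ∞) (fun x => σ x ξ))
    (hb : ∀ (L : List (Fin n)), L.length ≤ n + 1 → ∀ (x ξ : Fin n → ℝ), 1 ≤ ‖ξ‖ →
            ‖pderivs L (fun y => σ y ξ) x‖ ≤ A * ‖ξ‖⁻¹)
    (N : ℕ) (hN : 0 < N) (f : (Fin n → ℤ) → (Fin d → ℂ))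
    (hf : Summable (fun k => ‖f k‖ ^ 2))
    (hfN : ∀ k : Fin n → ℤ, ‖(fun i => (k i : ℝ))‖ < (N : ℝ) → f k = 0) :
    Summable (fun q => ‖opCoeff σ f q‖ ^ 2) ∧
      (∑' q, ‖opCoeff σ f q‖ ^ 2) ≤
        (((∑' p : Fin n → ℤ, wt p) + 1) * A / N) ^ 2 * ∑' k, ‖f k‖ ^ 2 := by
  have hN' : (0 : ℝ) < N := by exact_mod_cast hN
  have hN1 : (1 : ℝ) ≤ N := by exact_mod_cast hN
  obtain ⟨y1, y2, y3⟩ := young wt (fun k => ‖f k‖) wt_nonneg (summable_wt n)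
    (fun k => norm_nonneg _) hf
  have hterm : ∀ q k : Fin n → ℤ, ‖(if k = 0 then 0 else
      (symbolCoeff σ (q - k) (fun i => (k i : ℝ))) (f k) : Fin d → ℂ)‖ ≤
      A / N * (wt (q - k) * ‖f k‖) := by
    intro q k
    have hnn : 0 ≤ A / N * (wt (q - k) * ‖f k‖) :=
      mul_nonneg (by positivity) (mul_nonneg (wt_nonneg _) (norm_nonneg _))
    split_ifs with hk
    · simpa using hnn
    by_cases hkN : ‖(fun i => (k i : ℝ))‖ < (N : ℝ)
    · simp [hfN k hkN]
    rw [not_lt] at hkN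
    have hk0 : (fun i => (k i : ℝ)) ≠ 0 := by
      rw [← norm_pos_iff]; linarith
    have := coeff_bound (fun x => σ x (fun i => (k i : ℝ))) (fun x m => hper x m _) (hc _ hk0)
      (A * ‖(fun i => (k i : ℝ))‖⁻¹) (fun L hL x => hb L hL x _ (hN1.trans hkN)) (q - k)
    have hs : ‖symbolCoeff σ (q - k) (fun i => (k i : ℝ))‖ ≤ A / N * wt (q - k) := by
      refine this.trans ?_
      rw [div_eq_mul_inv]
      have := wt_nonneg (q - k)
      gcongr
    calc _ ≤ ‖symbolCoeff σ (q - k) (fun i => (k i : ℝ))‖ * ‖f k‖ :=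
          ContinuousLinearMap.le_opNorm _ _
      _ ≤ A / N * wt (q - k) * ‖f k‖ := by gcongr
      _ = _ := by ring
  have hop : ∀ q, ‖opCoeff σ f q‖ ≤ A / N * ∑' k, wt (q - k) * ‖f k‖ := by
    intro q
    rw [← tsum_mul_left]
    exact tsum_of_norm_bounded ((y1 q).mul_left _).hasSum (hterm q)
  have hop2 : ∀ q, ‖opCoeff σ f q‖ ^ 2 ≤ (A / N) ^ 2 * (∑' k, wt (q - k) * ‖f k‖) ^ 2 := by
    intro q
    rw [← mul_pow]
    exact pow_le_pow_left₀ (norm_nonneg _) (hop q) 2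
  have hsum : Summable (fun q => ‖opCoeff σ f q‖ ^ 2) :=
    Summable.of_nonneg_of_le (fun q => sq_nonneg _) hop2 (y2.mul_left _)
  refine ⟨hsum, ?_⟩
  have hW : 0 ≤ ∑' p : Fin n → ℤ, wt p := tsum_nonneg wt_nonneg
  have hF : 0 ≤ ∑' k, ‖f k‖ ^ 2 := tsum_nonneg fun k => sq_nonneg _
  calc _ ≤ ∑' q, (A / N) ^ 2 * (∑' k, wt (q - k) * ‖f k‖) ^ 2 :=
        hsum.tsum_le_tsum hop2 (y2.mul_left _)
    _ = (A / N) ^ 2 * ∑' q, (∑' k, wt (q - k) * ‖f k‖) ^ 2 := tsum_mul_left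
    _ ≤ (A / N) ^ 2 * ((∑' p : Fin n → ℤ, wt p) ^ 2 * ∑' k, ‖f k‖ ^ 2) := by gcongr
    _ ≤ (A / N) ^ 2 * (((∑' p : Fin n → ℤ, wt p) + 1) ^ 2 * ∑' k, ‖f k‖ ^ 2) := by
        gcongr; linarith
    _ = _ := by ring

/-- If `{σ_ι}` is a family of symbols with `|∂_x^α σ_ι(x,ξ)| ≤ A |ξ|⁻¹` for all
`|ξ| ≥ 1`, `|α| ≤ n+1` and all `ι`, then the operators `U_ι = Op[σ_ι]` form a uniformly
compact family:  quantitatively `‖U_ι (I − P_N)‖ ≤ C A / N` with `C = C(n,d)` (stated here as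
an `L²`-bound on every `f` whose Fourier support lies in `{|k| ≥ N}`), and consequently
`sup_ι ‖U_ι − U_ι P_N‖ → 0` as `N → ∞`. -/
theorem op_family_uniformly_compact (n d : ℕ) :
    ∃ C : ℝ, 0 < C ∧
      ∀ (I : Type) (σ : I → (Fin n → ℝ) → (Fin n → ℝ) → ((Fin d → ℂ) →L[ℂ] (Fin d → ℂ)))
        (A : ℝ), 0 < A →
        (∀ ι (x : Fin n → ℝ) (m : Fin n → ℤ) ξ,
          σ ι (x + fun i => (m i : ℝ)) ξ = σ ι x ξ) →
        (∀ ι (ξ : Fin n → ℝ), ξ ≠ 0 → ContDiff ℝ (⊤ : ℕ∞) (fun x => σ ι x ξ)) →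
        (∀ ι (L : List (Fin n)), L.length ≤ n + 1 →
          ∀ (x ξ : Fin n → ℝ), 1 ≤ ‖ξ‖ →
            ‖pderivs L (fun y => σ ι y ξ) x‖ ≤ A * ‖ξ‖⁻¹) →
        ((∀ (N : ℕ), 0 < N → ∀ ι (f : (Fin n → ℤ) → (Fin d → ℂ)),
            Summable (fun k => ‖f k‖ ^ 2) →
            (∀ k : Fin n → ℤ, ‖(fun i => (k i : ℝ))‖ < (N : ℝ) → f k = 0) →
            Summable (fun q => ‖opCoeff (σ ι) f q‖ ^ 2) ∧
            (∑' q, ‖opCoeff (σ ι) f q‖ ^ 2) ≤ (C * A / N) ^ 2 * ∑' k, ‖f k‖ ^ 2) ∧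
          ∀ δ : ℝ, 0 < δ → ∃ N₀ : ℕ, ∀ N ≥ N₀, ∀ ι (f : (Fin n → ℤ) → (Fin d → ℂ)),
            Summable (fun k => ‖f k‖ ^ 2) →
            (∀ k : Fin n → ℤ, ‖(fun i => (k i : ℝ))‖ < (N : ℝ) → f k = 0) →
            (∑' q, ‖opCoeff (σ ι) f q‖ ^ 2) ≤ δ ^ 2 * ∑' k, ‖f k‖ ^ 2) := by
  have hW : 0 ≤ ∑' p : Fin n → ℤ, wt p := tsum_nonneg wt_nonneg
  refine ⟨(∑' p : Fin n → ℤ, wt p) + 1, by linarith, ?_⟩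
  intro I σ A hA hper hc hb
  have main := fun ι => op_bound (σ ι) A hA (hper ι) (hc ι) (hb ι)
  refine ⟨fun N hN ι f hf hfN => main ι N hN f hf hfN, ?_⟩
  intro δ hδ
  obtain ⟨N₀, hN₀⟩ := exists_nat_gt (((∑' p : Fin n → ℤ, wt p) + 1) * A / δ)
  refine ⟨N₀ + 1, fun N hN ι f hf hfN => ?_⟩
  have hNpos : 0 < N := by omega
  have hN' : (0 : ℝ) < N := by exact_mod_cast hNpos
  refine (main ι N hNpos f hf hfN).2.trans ?_
  have hF : 0 ≤ ∑' k, ‖f k‖ ^ 2 := tsum_nonneg fun k => sq_nonneg _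
  have hle : ((∑' p : Fin n → ℤ, wt p) + 1) * A / N ≤ δ := by
    have : (N₀ : ℝ) ≤ N := by exact_mod_cast (by omega : N₀ ≤ N)
    rw [div_lt_iff₀ hδ] at hN₀
    rw [div_le_iff₀ hN']
    nlinarith
  gcongr

end
end
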